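/- For every r ∈ (0,1), one has −r·(105 − 145r² + 15r⁴ + 9r⁶) + 3·(r²−1)²·(35 + 10r² + 3r⁴)·arctanh r > 0. -/

import Mathlib

/-- The real inverse hyperbolic tangent, `arctanh r = (1/2)·ln((1+r)/(1−r))`. -/
noncomputable def arctanh (r : ℝ) : ℝ := (1/2) * Real.log ((1 + r) / (1 - r))

theorem hasDerivAt_arctanh {x : ℝ} (h0 : -1 < x) (h1 : x < 1) :
    HasDerivAt arctanh (1 / (1 - x ^ 2)) x := by
  have hp : 0 < 1 + x := by linarith
  have hm : 0 < 1 - x := by linarith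
  have h := ((((hasDerivAt_id x).const_add 1).div ((hasDerivAt_id x).const_sub 1) hm.ne').log
    (div_pos hp hm).ne').const_mul (1 / 2 : ℝ)
  convert! h using 1
  have hs : 1 - x ^ 2 = (1 + x) * (1 - x) := by ring
  simp only [id, Pi.div_apply, hs]
  field_simp
  ring

/-- The difference between `arctanh` and its rational lower bound has derivative
`1024 x ^ 8 / ((1 - x ^ 2) ^ 3 * (35 + 10 * x ^ 2 + 3 * x ^ 4) ^ 2)`. -/
theorem hasDerivAt_arctanh_sub_rational {x : ℝ} (h0 : -1 < x) (h1 : x < 1) :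
    HasDerivAt (fun y : ℝ => arctanh y - y * (105 - 145 * y ^ 2 + 15 * y ^ 4 + 9 * y ^ 6) /
        (3 * (y ^ 2 - 1) ^ 2 * (35 + 10 * y ^ 2 + 3 * y ^ 4)))
      (1024 * x ^ 8 / ((1 - x ^ 2) ^ 3 * (35 + 10 * x ^ 2 + 3 * x ^ 4) ^ 2)) x := by
  have hs : 1 - x ^ 2 ≠ 0 := by nlinarith
  have hs' : x ^ 2 - 1 ≠ 0 := fun h => hs (by linarith)
  have hQ : 35 + 10 * x ^ 2 + 3 * x ^ 4 ≠ 0 := by positivity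
  have hpow (n : ℕ) (c : ℝ) : HasDerivAt (fun y : ℝ => c * y ^ n) (c * (n * x ^ (n - 1))) x :=
    (hasDerivAt_pow n x).const_mul c
  have hN : HasDerivAt (fun y : ℝ => y * (105 - 145 * y ^ 2 + 15 * y ^ 4 + 9 * y ^ 6)) _ x :=
    (hasDerivAt_id' x).mul ((((hpow 2 145).const_sub 105).add (hpow 4 15)).add (hpow 6 9))
  have hD : HasDerivAt (fun y : ℝ => 3 * (y ^ 2 - 1) ^ 2 * (35 + 10 * y ^ 2 + 3 * y ^ 4)) _ x :=
    ((((hasDerivAt_pow 2 x).sub_const 1).pow 2).const_mul 3).mul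
      (((hpow 2 10).const_add 35).add (hpow 4 3))
  convert! (hasDerivAt_arctanh h0 h1).sub
    (hN.div hD (mul_ne_zero (mul_ne_zero three_ne_zero (pow_ne_zero 2 hs')) hQ)) using 1
  have hneg : x ^ 2 - 1 = -(1 - x ^ 2) := by ring
  simp only [Pi.pow_apply, hneg]
  field_simp
  push_cast
  ring

/-- Positivity of (the transcendental factor of) the Wronskian `W₆` on `(0,1)`. -/
theorem W6_pos (r : ℝ) (hr : r ∈ Set.Ioo (0:ℝ) 1) :
    -r * (105 - 145 * r ^ 2 + 15 * r ^ 4 + 9 * r ^ 6) +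
      3 * (r ^ 2 - 1) ^ 2 * (35 + 10 * r ^ 2 + 3 * r ^ 4) * arctanh r > 0 := by
  obtain ⟨h0, h1⟩ := hr
  have hmono := strictMonoOn_of_deriv_pos (convex_Icc 0 r)
    (f := fun y : ℝ => arctanh y - y * (105 - 145 * y ^ 2 + 15 * y ^ 4 + 9 * y ^ 6) /
        (3 * (y ^ 2 - 1) ^ 2 * (35 + 10 * y ^ 2 + 3 * y ^ 4)))
    (fun x hx => (hasDerivAt_arctanh_sub_rational (by linarith [hx.1])
      (by linarith [hx.2])).continuousAt.continuousWithinAt)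
    (fun x hx => by
      rw [interior_Icc] at hx
      obtain ⟨hx0, hxr⟩ := hx
      rw [(hasDerivAt_arctanh_sub_rational (by linarith) (by linarith)).deriv]
      have hs : 0 < 1 - x ^ 2 := by nlinarith
      positivity)
  have h := hmono (Set.left_mem_Icc.2 h0.le) (Set.right_mem_Icc.2 h0.le) h0
  have hs : r ^ 2 - 1 ≠ 0 := by nlinarith
  have hD : 0 < 3 * (r ^ 2 - 1) ^ 2 * (35 + 10 * r ^ 2 + 3 * r ^ 4) := by positivity
  simp only [arctanh, add_zero, sub_zero, div_one, Real.log_one, mul_zero, zero_mul, zero_div,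
    sub_pos] at h
  rw [div_lt_iff₀ hD] at h
  simp only [arctanh]
  linarith
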